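/- arXiv:1610.01449 — 7 statements merged into one kernel-verified Lean document; each statement's English description precedes it below -/
import Mathlib

section
/- Let n ≥ 1 and let u = (u_1,…,u_n) and v = (v_1,…,v_n) be n-tuples of real numbers with u_i ≥ 1 and v_i ≥ 1 for all i. If v is majorized by u, then for every real p ≥ 1 one has Σ_{i=1}^n ((u_i + √(u_i² − 1))^p + (u_i − √(u_i² − 1))^p) ≥ Σ_{i=1}^n ((v_i + √(v_i² − 1))^p + (v_i − √(v_i² − 1))^p). (These are the sums of the p-th powers of the roots of P(t) = ∏_i (t² − 2u_i t + 1) and Q(t) = ∏_i (t² − 2v_i t + 1), respectively; this is the p ≥ 1 half of the power majorization of the roots of Q by the roots of P.) -/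
/-- The sum of the `k` largest entries of `x`, expressed as the supremum of the
sums of `x` over all subsets of cardinality `k`. -/
noncomputable def kLargestSum {n : ℕ} (x : Fin n → ℝ) (k : ℕ) : ℝ :=
  sSup {y : ℝ | ∃ s : Finset (Fin n), s.card = k ∧ y = ∑ i ∈ s, x i}

/-- `v` is majorized by `u`: for each `k` from `1` to `n-1` the sum of the `k` largest
entries of `v` is at most the sum of the `k` largest entries of `u`, and the total
sums are equal. -/
def IsMajorizedBy {n : ℕ} (v u : Fin n → ℝ) : Prop :=
  (∀ k : ℕ, 1 ≤ k → k ≤ n - 1 → kLargestSum v k ≤ kLargestSum u k) ∧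
  ∑ i, v i = ∑ i, u i

lemma kLargestSum_comp_perm {n : ℕ} (x : Fin n → ℝ) (σ : Equiv.Perm (Fin n)) (k : ℕ) :
    kLargestSum (x ∘ σ) k = kLargestSum x k := by
  unfold kLargestSum
  congr 1
  ext y
  constructor
  · rintro ⟨s, hs, rfl⟩
    exact ⟨s.map σ.toEmbedding, by simpa using hs, by simp⟩
  · rintro ⟨s, hs, rfl⟩
    exact ⟨s.map σ.symm.toEmbedding, by simpa using hs, by simp⟩

lemma card_filter_fin_val_lt {n k : ℕ} (hkn : k ≤ n) :
    (Finset.univ.filter fun i : Fin n => i.val < k).card = k := by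
  rw [Fin.card_filter_val_lt, min_eq_right hkn]

lemma Antitone.sum_le_sum_filter_lt {n k : ℕ} {w : Fin n → ℝ} (hw : Antitone w)
    (hk : 1 ≤ k) (hkn : k ≤ n) {s : Finset (Fin n)} (hs : s.card = k) :
    ∑ i ∈ s, w i ≤ ∑ i with i.val < k, w i := by
  set t := w ⟨k - 1, by omega⟩ with ht
  have h : ∑ i ∈ s, (w i - t) ≤ ∑ i with i.val < k, (w i - t) := by
    calc ∑ i ∈ s, (w i - t) ≤ ∑ i ∈ s, max (w i - t) 0 :=
          Finset.sum_le_sum fun i _ => le_max_left _ _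
      _ ≤ ∑ i, max (w i - t) 0 :=
          Finset.sum_le_sum_of_subset_of_nonneg (Finset.subset_univ s)
            fun i _ _ => le_max_right _ _
      _ = ∑ i with i.val < k, (w i - t) := by
          rw [Finset.sum_filter]
          refine Finset.sum_congr rfl fun i _ => ?_
          split_ifs with hi
          · exact max_eq_left (sub_nonneg.2 (hw (Fin.mk_le_mk.2 (by omega))))
          · exact max_eq_right (sub_nonpos.2 (hw (Fin.mk_le_mk.2 (by omega))))
  simp only [Finset.sum_sub_distrib, Finset.sum_const, hs, card_filter_fin_val_lt hkn] at h
  linarith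

lemma Antitone.kLargestSum_eq {n k : ℕ} {w : Fin n → ℝ} (hw : Antitone w)
    (hk : 1 ≤ k) (hkn : k ≤ n) : kLargestSum w k = ∑ i with i.val < k, w i := by
  refine IsGreatest.csSup_eq ⟨⟨_, card_filter_fin_val_lt hkn, rfl⟩, ?_⟩
  rintro _ ⟨s, hs, rfl⟩
  exact hw.sum_le_sum_filter_lt hk hkn hs

lemma mul_sum_range_le_sum_range_mul {c d : ℕ → ℝ} {n : ℕ}
    (hc : ∀ i < n, c (i + 1) ≤ c i) (hd : ∀ k, k ≤ n → 0 ≤ ∑ i ∈ Finset.range k, d i) :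
    c n * ∑ i ∈ Finset.range (n + 1), d i ≤ ∑ i ∈ Finset.range (n + 1), c i * d i := by
  induction n with
  | zero => simp
  | succ n ih =>
    have h := ih (fun i hi => hc i (by omega)) (fun k hk => hd k (by omega))
    have hmul := mul_le_mul_of_nonneg_right (hc n (by omega)) (hd (n + 1) le_rfl)
    rw [Finset.sum_range_succ d, Finset.sum_range_succ fun i => c i * d i, mul_add]
    linarith

lemma sum_mul_nonneg_of_antitone {n : ℕ} {c d : Fin n → ℝ} (hc : Antitone c)
    (hd : ∀ k, 1 ≤ k → k ≤ n - 1 → 0 ≤ ∑ i with i.val < k, d i) (hsum : ∑ i, d i = 0) :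
    0 ≤ ∑ i, c i * d i := by
  obtain _ | n := n
  · simp
  let c' : ℕ → ℝ := fun i => c (Fin.ofNat (n + 1) i)
  let d' : ℕ → ℝ := fun i => d (Fin.ofNat (n + 1) i)
  have hpartial : ∀ k ≤ n, ∑ i ∈ Finset.range k, d' i =
      ∑ i : Fin (n + 1) with i.val < k, d i := by
    intro k hk
    refine (Finset.sum_bij (fun i _ => i.val) ?_ ?_ ?_ ?_).symm
    · simp
    · exact fun _ _ _ _ h => Fin.ext h
    · intro b hb
      have hbk := Finset.mem_range.1 hb
      exact ⟨⟨b, by omega⟩, by simpa using hbk, rfl⟩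
    · simp [d']
  have hsum' : ∑ i ∈ Finset.range (n + 1), d' i = 0 := by
    rw [Finset.sum_range, ← hsum]
    simp [d']
  have h : c' n * ∑ i ∈ Finset.range (n + 1), d' i ≤
      ∑ i ∈ Finset.range (n + 1), c' i * d' i := by
    refine mul_sum_range_le_sum_range_mul (fun i hi => hc ?_) fun k hk => ?_
    · rw [Fin.le_def, Fin.val_ofNat, Fin.val_ofNat, Nat.mod_eq_of_lt (by omega),
        Nat.mod_eq_of_lt (by omega)]
      omega
    · obtain rfl | hk0 := Nat.eq_zero_or_pos k
      · simp
      · rw [hpartial k hk]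
        exact hd k hk0 hk
  rw [hsum', mul_zero, Finset.sum_range] at h
  simpa [c', d'] using h

lemma exists_perm_antitone_comp {n : ℕ} (x : Fin n → ℝ) :
    ∃ σ : Equiv.Perm (Fin n), Antitone (x ∘ σ) :=
  ⟨Tuple.sort fun i => -x i, fun _ _ hij =>
    neg_le_neg_iff.1 (Tuple.monotone_sort (fun i => -x i) hij)⟩

/-- Karamata's inequality for a function `f` with a subgradient `c` at every point of `s`. -/
lemma IsMajorizedBy.sum_le_sum {n : ℕ} {u v : Fin n → ℝ} (h : IsMajorizedBy v u)
    {s : Set ℝ} {f c : ℝ → ℝ} (hf : ∀ x ∈ s, ∀ y ∈ s, f x + c x * (y - x) ≤ f y)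
    (hu : ∀ i, u i ∈ s) (hv : ∀ i, v i ∈ s) : ∑ i, f (v i) ≤ ∑ i, f (u i) := by
  have hc : MonotoneOn c s := by
    intro x hx y hy hxy
    obtain rfl | hlt := hxy.eq_or_lt
    · rfl
    · have h₁ := hf x hx y hy
      have h₂ := hf y hy x hx
      by_contra! hlt'
      nlinarith [mul_pos (sub_pos.2 hlt) (sub_pos.2 hlt')]
  obtain ⟨σ, hσ⟩ := exists_perm_antitone_comp v
  obtain ⟨τ, hτ⟩ := exists_perm_antitone_comp u
  have hnonneg : 0 ≤ ∑ i, c (v (σ i)) * (u (τ i) - v (σ i)) := by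
    refine sum_mul_nonneg_of_antitone (fun i j hij => hc (hv _) (hv _) (hσ hij)) ?_ ?_
    · intro k hk hkn
      have hle := h.1 k hk hkn
      rw [← kLargestSum_comp_perm v σ, ← kLargestSum_comp_perm u τ,
        hσ.kLargestSum_eq hk (by omega), hτ.kLargestSum_eq hk (by omega)] at hle
      rw [Finset.sum_sub_distrib]
      exact sub_nonneg.2 hle
    · rw [Finset.sum_sub_distrib, Equiv.sum_comp τ u, Equiv.sum_comp σ v, h.2, sub_self]
  rw [← Equiv.sum_comp σ fun i => f (v i), ← Equiv.sum_comp τ fun i => f (u i)]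
  have hsub := Finset.sum_le_sum fun i (_ : i ∈ Finset.univ) =>
    hf (v (σ i)) (hv _) (u (τ i)) (hu _)
  rw [Finset.sum_add_distrib] at hsub
  linarith

lemma sinh_mul_mul_cosh_le {p t : ℝ} (hp : 1 ≤ p) (ht : 0 ≤ t) :
    Real.sinh (p * t) * Real.cosh t ≤ p * Real.cosh (p * t) * Real.sinh t := by
  let g : ℝ → ℝ := fun t => p * Real.cosh (p * t) * Real.sinh t - Real.sinh (p * t) * Real.cosh t
  have hderiv : ∀ x, HasDerivAt g ((p ^ 2 - 1) * Real.sinh (p * x) * Real.sinh x) x := by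
    intro x
    have hlin : HasDerivAt (fun x => p * x) p x := by simpa using (hasDerivAt_id x).const_mul p
    have := ((hlin.cosh.const_mul p).mul (Real.hasDerivAt_sinh x)).sub
      (hlin.sinh.mul (Real.hasDerivAt_cosh x))
    refine this.congr_deriv ?_
    ring
  have hmono : MonotoneOn g (Set.Ici 0) := by
    refine monotoneOn_of_hasDerivWithinAt_nonneg (convex_Ici 0)
      (fun x _ => (hderiv x).continuousAt.continuousWithinAt)
      (fun x _ => (hderiv x).hasDerivWithinAt) fun x hx => ?_
    rw [interior_Ici] at hx
    have hx0 : 0 ≤ x := (Set.mem_Ioi.1 hx).le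
    exact mul_nonneg (mul_nonneg (by nlinarith)
      (Real.sinh_nonneg_iff.2 (mul_nonneg (by linarith) hx0))) (Real.sinh_nonneg_iff.2 hx0)
  have h := hmono Set.self_mem_Ici (Set.mem_Ici.2 ht) ht
  simp only [g, mul_zero, Real.sinh_zero, zero_mul, sub_zero] at h
  linarith

lemma hasDerivAt_cosh_mul_arcosh (p : ℝ) {x : ℝ} (hx : 1 < x) :
    HasDerivAt (fun x => Real.cosh (p * Real.arcosh x))
      (p * Real.sinh (p * Real.arcosh x) / Real.sinh (Real.arcosh x)) x := by
  refine ((Real.hasDerivAt_arcosh hx).const_mul p).cosh.congr_deriv ?_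
  rw [Real.sinh_arcosh hx.le, div_eq_mul_inv]
  ring

lemma convexOn_cosh_mul_arcosh {p : ℝ} (hp : 1 ≤ p) :
    ConvexOn ℝ (Set.Ici 1) fun x => Real.cosh (p * Real.arcosh x) := by
  refine convexOn_of_hasDerivWithinAt2_nonneg (convex_Ici 1)
    (f' := fun x => p * Real.sinh (p * Real.arcosh x) / Real.sinh (Real.arcosh x))
    (f'' := fun x => p * (p * Real.cosh (p * Real.arcosh x) * Real.sinh (Real.arcosh x) -
      Real.sinh (p * Real.arcosh x) * Real.cosh (Real.arcosh x)) /
        Real.sinh (Real.arcosh x) ^ 3) ?_ ?_ ?_ ?_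
  · exact Real.continuous_cosh.comp_continuousOn
      (continuousOn_const.mul Real.continuousOn_arcosh)
  · intro x hx
    rw [interior_Ici] at hx
    exact (hasDerivAt_cosh_mul_arcosh p hx).hasDerivWithinAt
  · intro x hx
    rw [interior_Ici] at hx
    have hs : Real.sinh (Real.arcosh x) ≠ 0 := (Real.sinh_pos_iff.2 (Real.arcosh_pos hx)).ne'
    have ha := Real.hasDerivAt_arcosh hx
    refine ((((ha.const_mul p).sinh.const_mul p).div ha.sinh hs).congr_deriv
      ?_).hasDerivWithinAt
    rw [← Real.sinh_arcosh (le_of_lt hx)]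
    field_simp
  · intro x hx
    rw [interior_Ici] at hx
    have hx1 : 1 ≤ x := le_of_lt hx
    have h := sinh_mul_mul_cosh_le hp (Real.arcosh_nonneg hx1)
    have hs := Real.sinh_nonneg_iff.2 (Real.arcosh_nonneg hx1)
    exact div_nonneg (mul_nonneg (by linarith) (by linarith)) (pow_nonneg hs 3)

lemma cosh_mul_arcosh_add_le {p x y : ℝ} (hp : 1 ≤ p) (hx : 1 ≤ x) (hy : 1 ≤ y) :
    Real.cosh (p * Real.arcosh x) +
      p * Real.sinh (p * Real.arcosh x) / Real.sinh (Real.arcosh x) * (y - x) ≤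
        Real.cosh (p * Real.arcosh y) := by
  obtain rfl | hx1 := hx.eq_or_lt
  · simp [Real.one_le_cosh]
  have hd := hasDerivAt_cosh_mul_arcosh p hx1
  have hconv := convexOn_cosh_mul_arcosh hp
  obtain hlt | rfl | hlt := lt_trichotomy x y
  · have h := hconv.le_slope_of_hasDerivAt (Set.mem_Ici.2 hx) (Set.mem_Ici.2 hy) hlt hd
    rw [slope_def_field, le_div_iff₀ (sub_pos.2 hlt)] at h
    linarith
  · simp
  · have h := hconv.slope_le_of_hasDerivAt (Set.mem_Ici.2 hy) (Set.mem_Ici.2 hx) hlt hd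
    rw [slope_def_field, div_le_iff₀ (sub_pos.2 hlt)] at h
    linarith

lemma rpow_add_rpow_eq_two_mul_cosh (p : ℝ) {x : ℝ} (hx : 1 ≤ x) :
    (x + Real.sqrt (x ^ 2 - 1)) ^ p + (x - Real.sqrt (x ^ 2 - 1)) ^ p =
      2 * Real.cosh (p * Real.arcosh x) := by
  have hneg : x - Real.sqrt (x ^ 2 - 1) = Real.exp (-Real.arcosh x) := by
    rw [← Real.cosh_sub_sinh, Real.cosh_arcosh hx, Real.sinh_arcosh hx]
  rw [hneg, ← Real.exp_arcosh hx, ← Real.exp_mul, ← Real.exp_mul, Real.cosh_eq]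
  ring_nf

theorem power_majorization_ge_one (n : ℕ) (hn : 1 ≤ n) (u v : Fin n → ℝ)
    (hu : ∀ i, 1 ≤ u i) (hv : ∀ i, 1 ≤ v i) (hmaj : IsMajorizedBy v u)
    (p : ℝ) (hp : 1 ≤ p) :
    ∑ i, ((v i + Real.sqrt ((v i) ^ 2 - 1)) ^ p + (v i - Real.sqrt ((v i) ^ 2 - 1)) ^ p) ≤
      ∑ i, ((u i + Real.sqrt ((u i) ^ 2 - 1)) ^ p + (u i - Real.sqrt ((u i) ^ 2 - 1)) ^ p) := by
  simp only [rpow_add_rpow_eq_two_mul_cosh p (hu _), rpow_add_rpow_eq_two_mul_cosh p (hv _),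
    ← Finset.mul_sum]
  exact mul_le_mul_of_nonneg_left
    (hmaj.sum_le_sum (s := Set.Ici 1) (fun x hx y hy => cosh_mul_arcosh_add_le hp hx hy) hu hv)
    zero_le_two
end

section
/- Fix a real number p with 0 < p < 1. The function g defined for t > 1 by g(t) = ((t + √(t² − 1))^p − (t − √(t² − 1))^p)/√(t² − 1) is monotone decreasing on (1, ∞): for all 1 < s ≤ t one has g(s) ≥ g(t). -/
open Set

/-- On `[0, ∞)`, the inequality `p * tanh x ≤ tanh (p * x)` for `0 ≤ p ≤ 1`, with denominators
cleared. -/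
theorem Real.mul_cosh_mul_sinh_le_sinh_mul_cosh {p x : ℝ} (hp0 : 0 ≤ p) (hp1 : p ≤ 1)
    (hx : 0 ≤ x) :
    p * Real.cosh (p * x) * Real.sinh x ≤ Real.sinh (p * x) * Real.cosh x := by
  have hd (y : ℝ) : HasDerivAt
      (fun y ↦ Real.sinh (p * y) * Real.cosh y - p * Real.cosh (p * y) * Real.sinh y)
      ((1 - p ^ 2) * (Real.sinh (p * y) * Real.sinh y)) y := by
    have hl : HasDerivAt (fun y : ℝ ↦ p * y) p y := by
      simpa using (hasDerivAt_id y).const_mul p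
    exact ((hl.sinh.mul (Real.hasDerivAt_cosh y)).sub
      ((hl.cosh.const_mul p).mul (Real.hasDerivAt_sinh y))).congr_deriv (by ring)
  have hmono : MonotoneOn
      (fun y ↦ Real.sinh (p * y) * Real.cosh y - p * Real.cosh (p * y) * Real.sinh y) (Ici 0) := by
    refine monotoneOn_of_deriv_nonneg (convex_Ici 0)
      (fun y _ ↦ (hd y).continuousAt.continuousWithinAt)
      (fun y _ ↦ (hd y).differentiableAt.differentiableWithinAt) fun y hy ↦ ?_
    rw [interior_Ici, mem_Ioi] at hy
    rw [(hd y).deriv]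
    exact mul_nonneg (by nlinarith) (mul_nonneg
      (Real.sinh_nonneg_iff.2 (by positivity)) (Real.sinh_nonneg_iff.2 hy.le))
  simpa using hmono self_mem_Ici hx hx

theorem Real.antitoneOn_sinh_mul_div_sinh {p : ℝ} (hp0 : 0 ≤ p) (hp1 : p ≤ 1) :
    AntitoneOn (fun x ↦ Real.sinh (p * x) / Real.sinh x) (Ioi 0) := by
  have hd (y : ℝ) (hy : 0 < y) : HasDerivAt (fun x ↦ Real.sinh (p * x) / Real.sinh x)
      ((p * Real.cosh (p * y) * Real.sinh y - Real.sinh (p * y) * Real.cosh y) /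
        Real.sinh y ^ 2) y := by
    have hl : HasDerivAt (fun y : ℝ ↦ p * y) p y := by
      simpa using (hasDerivAt_id y).const_mul p
    exact (hl.sinh.div (Real.hasDerivAt_sinh y) (Real.sinh_pos_iff.2 hy).ne').congr_deriv (by ring)
  refine antitoneOn_of_deriv_nonpos (convex_Ioi 0)
    (fun y hy ↦ (hd y hy).continuousAt.continuousWithinAt)
    (fun y hy ↦ (hd y (interior_subset hy)).differentiableAt.differentiableWithinAt)
    fun y hy ↦ ?_
  rw [interior_Ioi, mem_Ioi] at hy
  rw [(hd y hy).deriv]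
  exact div_nonpos_of_nonpos_of_nonneg
    (sub_nonpos.2 (mul_cosh_mul_sinh_le_sinh_mul_cosh hp0 hp1 hy.le)) (sq_nonneg _)

theorem Real.rpow_sub_rpow_div_sqrt_eq_sinh_arcosh (p : ℝ) {t : ℝ} (ht : 1 ≤ t) :
    ((t + Real.sqrt (t ^ 2 - 1)) ^ p - (t - Real.sqrt (t ^ 2 - 1)) ^ p) / Real.sqrt (t ^ 2 - 1) =
      2 * (Real.sinh (p * Real.arcosh t) / Real.sinh (Real.arcosh t)) := by
  have hplus : t + Real.sqrt (t ^ 2 - 1) = Real.exp (Real.arcosh t) := (Real.exp_arcosh ht).symm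
  have hminus : t - Real.sqrt (t ^ 2 - 1) = Real.exp (-Real.arcosh t) := by
    rw [← Real.cosh_sub_sinh, Real.cosh_arcosh ht, Real.sinh_arcosh ht]
  rw [hplus, hminus, ← Real.sinh_arcosh ht, ← Real.exp_mul, ← Real.exp_mul,
    Real.sinh_eq (p * _), mul_comm _ p, neg_mul, mul_comm _ p]
  ring

theorem g_antitone_lt_one (p : ℝ) (hp0 : 0 < p) (hp1 : p < 1) (s t : ℝ) (hs : 1 < s)
    (hst : s ≤ t) :
    ((t + Real.sqrt (t ^ 2 - 1)) ^ p - (t - Real.sqrt (t ^ 2 - 1)) ^ p) / Real.sqrt (t ^ 2 - 1) ≤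
      ((s + Real.sqrt (s ^ 2 - 1)) ^ p - (s - Real.sqrt (s ^ 2 - 1)) ^ p) /
        Real.sqrt (s ^ 2 - 1) := by
  have ht : 1 < t := hs.trans_le hst
  rw [Real.rpow_sub_rpow_div_sqrt_eq_sinh_arcosh p ht.le,
    Real.rpow_sub_rpow_div_sqrt_eq_sinh_arcosh p hs.le]
  exact mul_le_mul_of_nonneg_left
    (Real.antitoneOn_sinh_mul_div_sinh hp0.le hp1.le (Real.arcosh_pos hs) (Real.arcosh_pos ht)
      ((Real.arcosh_le_arcosh (by linarith) (by linarith)).2 hst)) zero_le_two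
end

section
/- For every real p ≥ 1 and every real θ with 0 < θ < 1, one has (pθ − 1)(1 + θ)^p + (pθ + 1)(1 − θ)^p ≥ 0. -/
/-- The function `x ↦ log (1 + x) - log (1 - x)` is superhomogeneous on `[0, 1)`. -/
theorem mul_log_one_add_sub_log_one_sub_le {p x : ℝ} (hp : 1 ≤ p) (hx : 0 ≤ x)
    (hpx : p * x < 1) :
    p * (Real.log (1 + x) - Real.log (1 - x)) ≤
      Real.log (1 + p * x) - Real.log (1 - p * x) := by
  have hx1 : |x| < 1 := by
    rw [abs_of_nonneg hx]
    nlinarith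
  have hpx1 : |p * x| < 1 := by
    rwa [abs_of_nonneg (by positivity)]
  refine hasSum_le (fun k => ?_) ((Real.hasSum_log_sub_log_of_abs_lt_one hx1).mul_left p)
    (Real.hasSum_log_sub_log_of_abs_lt_one hpx1)
  have hpk : p ≤ p ^ (2 * k + 1) := le_self_pow₀ hp (by omega)
  calc p * (2 * (1 / (2 * (k : ℝ) + 1)) * x ^ (2 * k + 1))
      = 2 * (1 / (2 * (k : ℝ) + 1)) * (p * x ^ (2 * k + 1)) := by ring
    _ ≤ 2 * (1 / (2 * (k : ℝ) + 1)) * (p ^ (2 * k + 1) * x ^ (2 * k + 1)) := by gcongr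
    _ = 2 * (1 / (2 * (k : ℝ) + 1)) * (p * x) ^ (2 * k + 1) := by rw [mul_pow]

theorem key_ineq_ge_one (p : ℝ) (hp : 1 ≤ p) (θ : ℝ) (hθ0 : 0 < θ) (hθ1 : θ < 1) :
    0 ≤ (p * θ - 1) * (1 + θ) ^ p + (p * θ + 1) * (1 - θ) ^ p := by
  have hadd : 0 < 1 + θ := by linarith
  have hsub : 0 < 1 - θ := by linarith
  have hpθ : 0 < p * θ := by positivity
  rcases le_or_gt 1 (p * θ) with h | h
  · have : 0 ≤ p * θ - 1 := by linarith
    positivity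
  · have hsub' : 0 < 1 - p * θ := by linarith
    have hadd' : 0 < 1 + p * θ := by linarith
    have key : (1 - p * θ) * (1 + θ) ^ p ≤ (1 + p * θ) * (1 - θ) ^ p := by
      rw [← Real.log_le_log_iff (by positivity) (by positivity),
        Real.log_mul hsub'.ne' (by positivity), Real.log_mul hadd'.ne' (by positivity),
        Real.log_rpow hadd, Real.log_rpow hsub]
      linarith [mul_log_one_add_sub_log_one_sub_le hp hθ0.le h]
    linarith
end

section
/- For every real p with 0 < p < 1 and every real θ with 0 < θ < 1, one has (pθ − 1)(1 + θ)^p + (pθ + 1)(1 − θ)^p ≤ 0. -/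
/-- The odd power series of `log (1 + x) - log (1 - x)` has nonnegative coefficients, so on `[0, 1)`
the function lies above its contractions towards `0`. -/
theorem log_sub_log_mul_le {p x : ℝ} (hp0 : 0 ≤ p) (hp1 : p ≤ 1) (hx0 : 0 ≤ x) (hx1 : x < 1) :
    Real.log (1 + p * x) - Real.log (1 - p * x) ≤ p * (Real.log (1 + x) - Real.log (1 - x)) := by
  have hpx0 : 0 ≤ p * x := mul_nonneg hp0 hx0
  have hpx1 : p * x < 1 := (mul_le_of_le_one_left hx0 hp1).trans_lt hx1
  refine hasSum_le (fun k => ?_)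
    (Real.hasSum_log_sub_log_of_abs_lt_one (by rwa [abs_of_nonneg hpx0]))
    ((Real.hasSum_log_sub_log_of_abs_lt_one (by rwa [abs_of_nonneg hx0])).mul_left p)
  have hpow : p ^ (2 * k + 1) ≤ p := pow_le_of_le_one hp0 hp1 (by omega)
  calc 2 * (1 / (2 * (k : ℝ) + 1)) * (p * x) ^ (2 * k + 1)
      = p ^ (2 * k + 1) * (2 * (1 / (2 * (k : ℝ) + 1)) * x ^ (2 * k + 1)) := by
        rw [mul_pow]; ring
    _ ≤ p * (2 * (1 / (2 * (k : ℝ) + 1)) * x ^ (2 * k + 1)) :=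
        mul_le_mul_of_nonneg_right hpow (by positivity)

theorem key_ineq_lt_one (p : ℝ) (hp0 : 0 < p) (hp1 : p < 1) (θ : ℝ) (hθ0 : 0 < θ)
    (hθ1 : θ < 1) :
    (p * θ - 1) * (1 + θ) ^ p + (p * θ + 1) * (1 - θ) ^ p ≤ 0 := by
  have hlog := log_sub_log_mul_le hp0.le hp1.le hθ0.le hθ1
  have hpθ : p * θ < 1 := (mul_le_of_le_one_left hθ0.le hp1.le).trans_lt hθ1
  have h₁ : 0 < 1 - θ := by linarith
  have h₂ : 0 < 1 + θ := by linarith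
  have h₃ : 0 < 1 - p * θ := by linarith
  have h₄ : 0 < 1 + p * θ := by positivity
  have h₅ : 0 < (1 - θ) ^ p := Real.rpow_pos_of_pos h₁ p
  have h₆ : 0 < (1 + θ) ^ p := Real.rpow_pos_of_pos h₂ p
  have key : (1 + p * θ) * (1 - θ) ^ p ≤ (1 - p * θ) * (1 + θ) ^ p := by
    rw [← Real.log_le_log_iff (by positivity) (by positivity), Real.log_mul h₄.ne' h₅.ne',
      Real.log_mul h₃.ne' h₆.ne', Real.log_rpow h₁, Real.log_rpow h₂]
    linarith
  linarith
end

section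
/- Let x = ((7 + √45)/2, (7 − √45)/2, 1, 1) be the vector of roots (with multiplicity) of P(t) = (t² − 7t + 1)(t² − 2t + 1), and let y = ((6 + √32)/2, (6 − √32)/2, (3 + √5)/2, (3 − √5)/2) be the vector of roots of Q(t) = (t² − 6t + 1)(t² − 3t + 1). Then y is power majorized by x: for every real p ≥ 1, Σ_{i=1}^4 y_i^p ≤ Σ_{i=1}^4 x_i^p, and for every real p with 0 < p < 1, Σ_{i=1}^4 y_i^p ≥ Σ_{i=1}^4 x_i^p. -/
/-- The roots of `P(t) = (t² − 7t + 1)(t² − 2t + 1)`. -/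
noncomputable def xvec : Fin 4 → ℝ :=
  ![(7 + Real.sqrt 45) / 2, (7 - Real.sqrt 45) / 2, 1, 1]

/-- The roots of `Q(t) = (t² − 6t + 1)(t² − 3t + 1)`. -/
noncomputable def yvec : Fin 4 → ℝ :=
  ![(6 + Real.sqrt 32) / 2, (6 - Real.sqrt 32) / 2,
    (3 + Real.sqrt 5) / 2, (3 - Real.sqrt 5) / 2]

open Real in
/-- The difference of power sums, halved, of `(e^(±2a), 1, 1)` and `(e^(±b), e^(±a))`
as a power series in `p`. -/
theorem hasSum_cosh_difference (a b p : ℝ) :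
    HasSum (fun k : ℕ => ((2 * a) ^ (2 * k) + 0 ^ (2 * k) - b ^ (2 * k) - a ^ (2 * k)) /
        (2 * k).factorial * p ^ (2 * k))
      (cosh (2 * a * p) + 1 - cosh (b * p) - cosh (a * p)) := by
  have h := (((hasSum_cosh (2 * a * p)).add (hasSum_cosh (0 * p))).sub
    (hasSum_cosh (b * p))).sub (hasSum_cosh (a * p))
  rw [show cosh (0 * p) = 1 by simp] at h
  refine (congrArg (HasSum · _) (funext fun k => ?_)).mp h
  simp only [mul_pow _ p]
  ring

theorem pow_add_one_le_four_pow {s : ℝ} (hs : 0 ≤ s) (hs' : s ≤ 15 / 4) {k : ℕ} (hk : 2 ≤ k) :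
    s ^ k + 1 ≤ 4 ^ k := by
  induction k, hk using Nat.le_induction with
  | base => nlinarith
  | succ k _ ih =>
    have := pow_nonneg hs k
    rw [pow_succ, pow_succ]
    nlinarith

theorem cosh_difference_coeff_nonneg {a b : ℝ} (ha : 0 ≤ a) (hb : 0 ≤ b)
    (hab : 8 * b ≤ 15 * a) {k : ℕ} (hk : 2 ≤ k) :
    0 ≤ ((2 * a) ^ (2 * k) + 0 ^ (2 * k) - b ^ (2 * k) - a ^ (2 * k)) /
      ((2 * k).factorial : ℝ) := by
  have hpow : b ^ (2 * k) ≤ (15 / 8 * a) ^ (2 * k) := pow_le_pow_left₀ hb (by linarith) _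
  have hnum := pow_add_one_le_four_pow (s := (15 / 8) ^ 2) (by norm_num) (by norm_num) hk
  have hapos : 0 ≤ a ^ (2 * k) := by positivity
  rw [mul_pow, pow_mul (15 / 8)] at hpow
  refine div_nonneg ?_ (by positivity)
  rw [mul_pow, pow_mul 2, zero_pow (by omega)]
  norm_num at hnum hpow ⊢
  nlinarith

open Real in
/-- If the difference vanishes at `p = 1`, its sign at `p` is that of `p - 1`. -/
theorem cosh_difference_sign {a b : ℝ} (ha : 0 ≤ a) (hb : 0 ≤ b) (hab : 8 * b ≤ 15 * a)
    (hone : cosh (2 * a) + 1 - cosh b - cosh a = 0) {p : ℝ} (hp : 0 ≤ p) :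
    (1 ≤ p → 0 ≤ cosh (2 * a * p) + 1 - cosh (b * p) - cosh (a * p)) ∧
      (p ≤ 1 → cosh (2 * a * p) + 1 - cosh (b * p) - cosh (a * p) ≤ 0) := by
  have h₁ := hasSum_cosh_difference a b 1
  simp only [mul_one, one_pow] at h₁
  rw [hone] at h₁
  have h := (hasSum_cosh_difference a b p).sub (h₁.mul_right (p ^ 2))
  simp only [zero_mul, sub_zero, ← mul_sub] at h
  constructor
  · intro hp1
    refine h.nonneg fun k => ?_
    match k with
    | 0 => simp
    | 1 => simp
    | k + 2 =>
      exact mul_nonneg (cosh_difference_coeff_nonneg ha hb hab (by omega))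
        (sub_nonneg.2 (pow_le_pow_right₀ hp1 (by omega)))
  · intro hp1
    refine h.nonpos fun k => ?_
    match k with
    | 0 => simp
    | 1 => simp
    | k + 2 =>
      exact mul_nonpos_of_nonneg_of_nonpos
        (cosh_difference_coeff_nonneg ha hb hab (by omega))
        (sub_nonpos.2 (pow_le_pow_of_le_one hp hp1 (by omega)))

open Real in
theorem rpow_add_rpow_eq_two_mul_cosh_s11 {u v c : ℝ} (hu : 0 < u) (huv : u * v = 1)
    (hc : log u = c) (p : ℝ) : u ^ p + v ^ p = 2 * cosh (c * p) := by
  obtain rfl : v = u⁻¹ := eq_inv_of_mul_eq_one_right huv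
  rw [rpow_def_of_pos hu, rpow_def_of_pos (inv_pos.2 hu), log_inv, hc, cosh_eq, neg_mul]
  ring

open Real in
/-- The difference of the power sums of `xvec` and `yvec` has the sign of `p - 1`. -/
theorem sum_xvec_sub_sum_yvec_sign {p : ℝ} (hp : 0 ≤ p) :
    (1 ≤ p → 0 ≤ ∑ i, xvec i ^ p - ∑ i, yvec i ^ p) ∧
      (p ≤ 1 → ∑ i, xvec i ^ p - ∑ i, yvec i ^ p ≤ 0) := by
  have h5 : √5 ^ 2 = 5 := sq_sqrt (by norm_num)
  have h32 : √32 ^ 2 = 32 := sq_sqrt (by norm_num)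
  have h45 : √45 = 3 * √5 := by
    rw [show (45 : ℝ) = 3 ^ 2 * 5 by norm_num, sqrt_mul (by norm_num), sqrt_sq (by norm_num)]
  have h5l : 2.236 ≤ √5 := le_sqrt_of_sq_le (by norm_num)
  have h32u : √32 ≤ 5.658 := sqrt_le_iff.2 ⟨by norm_num, by norm_num⟩
  have h32n := sqrt_nonneg 32
  obtain ⟨a, ha⟩ : ∃ a, log ((3 + √5) / 2) = a := ⟨_, rfl⟩
  obtain ⟨b, hb⟩ : ∃ b, log ((6 + √32) / 2) = b := ⟨_, rfl⟩
  have h2a : log ((7 + √45) / 2) = 2 * a := by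
    rw [← ha, ← log_rpow (by positivity), rpow_two, h45]
    congr 1
    linear_combination -h5 / 4
  have ha0 : 0 ≤ a := ha ▸ log_nonneg (by linarith)
  have hb0 : 0 ≤ b := hb ▸ log_nonneg (by linarith)
  have hab : 8 * b ≤ 15 * a := by
    suffices h : log (((6 + √32) / 2) ^ 8) ≤ log (((3 + √5) / 2) ^ 15) by
      rwa [log_pow, log_pow, ha, hb] at h
    refine log_le_log (by positivity) ?_
    calc ((6 + √32) / 2) ^ 8 ≤ 5.829 ^ 8 := pow_le_pow_left₀ (by positivity) (by linarith) _
      _ ≤ 2.618 ^ 15 := by norm_num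
      _ ≤ ((3 + √5) / 2) ^ 15 := pow_le_pow_left₀ (by norm_num) (by linarith) _
  have hX := rpow_add_rpow_eq_two_mul_cosh_s11 (v := (7 - √45) / 2) (by positivity)
    (by rw [h45]; linear_combination -9 * h5 / 4) h2a
  have hY := rpow_add_rpow_eq_two_mul_cosh_s11 (v := (6 - √32) / 2) (by positivity)
    (by linear_combination -h32 / 4) hb
  have hZ := rpow_add_rpow_eq_two_mul_cosh_s11 (v := (3 - √5) / 2) (by positivity)
    (by linear_combination -h5 / 4) ha
  have hone : cosh (2 * a) + 1 - cosh b - cosh a = 0 := by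
    have h1 := hX 1
    have h2 := hY 1
    have h3 := hZ 1
    simp only [rpow_one, mul_one] at h1 h2 h3
    linarith
  have hsum : ∑ i, xvec i ^ p - ∑ i, yvec i ^ p =
      2 * (cosh (2 * a * p) + 1 - cosh (b * p) - cosh (a * p)) := by
    simp only [Fin.sum_univ_four, xvec, yvec, Matrix.cons_val, one_rpow]
    linear_combination hX p - hY p - hZ p
  obtain ⟨hge, hle⟩ := cosh_difference_sign ha0 hb0 hab hone hp
  rw [hsum]
  exact ⟨fun h => by linarith [hge h], fun h => by linarith [hle h]⟩

theorem klemes_power_majorization :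
    (∀ p : ℝ, 1 ≤ p → ∑ i, yvec i ^ p ≤ ∑ i, xvec i ^ p) ∧
      ∀ p : ℝ, 0 < p → p < 1 → ∑ i, xvec i ^ p ≤ ∑ i, yvec i ^ p :=
  ⟨fun _ hp => sub_nonneg.1 ((sum_xvec_sub_sum_yvec_sign (by linarith)).1 hp),
    fun _ hp hp1 => sub_nonpos.1 ((sum_xvec_sub_sum_yvec_sign hp.le).2 hp1.le)⟩
end

section
/- Let A and B be the 4×4 real matrices with rows (1,1,1,1), (0,1,1,0), (0,0,1,0), (0,0,1,1) and (1,1,1,1), (0,1,1,0), (0,0,1,0), (0,0,1,−1) respectively, and let X = A·Aᵀ, Y = B·Bᵀ (both real symmetric, hence with real eigenvalues x_1,…,x_4 and y_1,…,y_4 counted with multiplicity, and all eigenvalues are positive). Then the eigenvalues of Y are power majorized by the eigenvalues of X: for every real p ≥ 1, Σ_{i=1}^4 y_i^p ≤ Σ_{i=1}^4 x_i^p, and for every real p with 0 < p < 1, Σ_{i=1}^4 y_i^p ≥ Σ_{i=1}^4 x_i^p. -/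
open Matrix

/-- The matrix `A`. -/
def matA : Matrix (Fin 4) (Fin 4) ℝ :=
  !![1, 1, 1, 1;
     0, 1, 1, 0;
     0, 0, 1, 0;
     0, 0, 1, 1]

/-- The matrix `B`. -/
def matB : Matrix (Fin 4) (Fin 4) ℝ :=
  !![1, 1, 1, 1;
     0, 1, 1, 0;
     0, 0, 1, 0;
     0, 0, 1, -1]

open Polynomial in
theorem charpoly_matA_mul_transpose :
    (matA * matAᵀ).charpoly = X ^ 4 - 9 * X ^ 3 + 16 * X ^ 2 - 9 * X + 1 := by
  have h : matA * matAᵀ = !![4, 2, 1, 2; 2, 2, 1, 1; 1, 1, 1, 1; 2, 1, 1, 2] := by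
    ext i j
    fin_cases i <;> fin_cases j <;>
      norm_num [matA, Matrix.mul_apply, Fin.sum_univ_succ]
  rw [h, Matrix.charpoly, Matrix.det_succ_row_zero]
  simp [Fin.sum_univ_succ, Matrix.det_fin_three, Matrix.charmatrix_apply, Fin.succAbove,
    map_ofNat C]
  ring

open Polynomial in
theorem charpoly_matB_mul_transpose :
    (matB * matBᵀ).charpoly = X ^ 4 - 9 * X ^ 3 + 20 * X ^ 2 - 9 * X + 1 := by
  have h : matB * matBᵀ = !![4, 2, 1, 0; 2, 2, 1, 1; 1, 1, 1, 1; 0, 1, 1, 2] := by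
    ext i j
    fin_cases i <;> fin_cases j <;>
      norm_num [matB, Matrix.mul_apply, Fin.sum_univ_succ]
  rw [h, Matrix.charpoly, Matrix.det_succ_row_zero]
  simp [Fin.sum_univ_succ, Matrix.det_fin_three, Matrix.charmatrix_apply, Fin.succAbove,
    map_ofNat C]
  ring

open Polynomial in
/-- A palindromic quartic whose roots are `exp (± x)` and `exp (± y)`. -/
theorem prod_X_sub_C_exp (x y : ℝ) :
    (({Real.exp x, Real.exp (-x), Real.exp y, Real.exp (-y)} : Multiset ℝ).map
      (fun a => X - C a)).prod =
      X ^ 4 - C (2 * Real.cosh x + 2 * Real.cosh y) * X ^ 3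
        + C (2 + 4 * Real.cosh x * Real.cosh y) * X ^ 2
        - C (2 * Real.cosh x + 2 * Real.cosh y) * X + 1 := by
  have quadratic (z : ℝ) : (X - C (Real.exp z)) * (X - C (Real.exp (-z))) =
      X ^ 2 - C (2 * Real.cosh z) * X + 1 := by
    have h1 : C (Real.exp z) * C (Real.exp (-z)) = 1 := by
      rw [← C_mul, ← Real.exp_add]; simp
    have h2 : C (2 * Real.cosh z) = C (Real.exp z) + C (Real.exp (-z)) := by
      rw [← C_add, Real.cosh_eq]; congr 1; ring
    rw [h2]
    linear_combination h1
  have key : (X - C (Real.exp x)) * ((X - C (Real.exp (-x))) *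
      ((X - C (Real.exp y)) * (X - C (Real.exp (-y))))) =
      (X ^ 2 - C (2 * Real.cosh x) * X + 1) * (X ^ 2 - C (2 * Real.cosh y) * X + 1) := by
    rw [← quadratic x, ← quadratic y]; ring
  simp only [Multiset.insert_eq_cons, Multiset.map_cons, Multiset.prod_cons,
    Multiset.map_singleton, Multiset.prod_singleton]
  rw [key]
  simp only [C_add, C_mul, map_ofNat]
  ring

open Polynomial in
theorem Matrix.IsHermitian.map_eigenvalues_eq_of_charpoly_eq {n : Type*} [Fintype n]
    [DecidableEq n] {M : Matrix n n ℝ} (hM : M.IsHermitian) {s : Multiset ℝ}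
    (h : M.charpoly = (s.map (fun a => X - C a)).prod) :
    Finset.univ.val.map hM.eigenvalues = s := by
  have h1 := hM.roots_charpoly_eq_eigenvalues
  rw [h, roots_multiset_prod_X_sub_C] at h1
  simpa using h1.symm

section

variable {n : Type*} [Fintype n] {f : n → ℝ} {x y : ℝ}

theorem pos_of_map_univ_eq_exp
    (h : Finset.univ.val.map f =
      {Real.exp x, Real.exp (-x), Real.exp y, Real.exp (-y)}) (i : n) : 0 < f i := by
  have hi : f i ∈ Finset.univ.val.map f := Multiset.mem_map_of_mem f (Finset.mem_univ i)
  rw [h] at hi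
  simp only [Multiset.insert_eq_cons, Multiset.mem_cons, Multiset.mem_singleton] at hi
  rcases hi with hi | hi | hi | hi <;> rw [hi] <;> exact Real.exp_pos _

theorem sum_rpow_eq_cosh_of_map_univ_eq_exp
    (h : Finset.univ.val.map f =
      {Real.exp x, Real.exp (-x), Real.exp y, Real.exp (-y)}) (p : ℝ) :
    ∑ i, f i ^ p = 2 * Real.cosh (p * x) + 2 * Real.cosh (p * y) := by
  have h1 : ∑ i, f i ^ p = ((Finset.univ.val.map f).map (· ^ p)).sum := by
    rw [Multiset.map_map]; rfl
  rw [h1, h]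
  simp only [Multiset.insert_eq_cons, Multiset.map_cons, Multiset.sum_cons,
    Multiset.map_singleton, Multiset.sum_singleton, ← Real.exp_mul, Real.cosh_eq]
  simp only [neg_mul, mul_comm p]
  ring

end

theorem pow_add_pow_le_pow_of_sq_add_sq_le_sq {a b c : ℝ} (hb : 0 ≤ b) (hc : 0 ≤ c)
    (hba : b ≤ a) (hca : c ≤ a) (h : b ^ 2 + c ^ 2 ≤ a ^ 2) {k : ℕ} (hk : 2 ≤ k) :
    b ^ k + c ^ k ≤ a ^ k := by
  have ha : 0 ≤ a := hb.trans hba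
  induction k, hk using Nat.le_induction with
  | base => exact h
  | succ k _ ih =>
    calc b ^ (k + 1) + c ^ (k + 1) = b ^ k * b + c ^ k * c := by ring
      _ ≤ b ^ k * a + c ^ k * a := by gcongr
      _ = (b ^ k + c ^ k) * a := by ring
      _ ≤ a ^ k * a := by gcongr
      _ = a ^ (k + 1) := by ring

/-- The power series in `p` of `1 + cosh (p x) - cosh (p y) - cosh (p z)`, with the quadratic
coefficient eliminated by means of the zero at `p = 1`. -/
theorem hasSum_one_add_cosh_sub_cosh_sub_cosh {x y z : ℝ}
    (h : 1 + Real.cosh x = Real.cosh y + Real.cosh z) (p : ℝ) :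
    HasSum (fun k : ℕ => ((x ^ 2) ^ (k + 1) - (y ^ 2) ^ (k + 1) - (z ^ 2) ^ (k + 1)) /
        (2 * (k + 1)).factorial * ((p ^ 2) ^ (k + 1) - p ^ 2))
      (1 + Real.cosh (p * x) - Real.cosh (p * y) - Real.cosh (p * z)) := by
  have series (q : ℝ) : HasSum (fun k : ℕ => ((x ^ 2) ^ k - (y ^ 2) ^ k - (z ^ 2) ^ k) /
        (2 * k).factorial * (q ^ 2) ^ k)
      (Real.cosh (q * x) - Real.cosh (q * y) - Real.cosh (q * z)) := by
    refine (((Real.hasSum_cosh (q * x)).sub (Real.hasSum_cosh (q * y))).sub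
      (Real.hasSum_cosh (q * z))).congr_fun ?_
    intro k
    simp only [pow_mul, mul_pow]
    ring
  have h1 := (series p).sub ((series 1).mul_left (p ^ 2))
  rw [← hasSum_nat_add_iff' 1] at h1
  simp only [one_mul, Finset.range_one, Finset.sum_singleton, pow_zero, mul_zero,
    Nat.factorial_zero, Nat.cast_one] at h1
  have h2 := h1.congr_fun (g := fun k : ℕ =>
    ((x ^ 2) ^ (k + 1) - (y ^ 2) ^ (k + 1) - (z ^ 2) ^ (k + 1)) /
      (2 * (k + 1)).factorial * ((p ^ 2) ^ (k + 1) - p ^ 2)) fun k => by ring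
  refine (congrArg (HasSum _ · _) ?_).mp h2
  linear_combination -(p ^ 2) * h

section

variable {x y z p : ℝ}

theorem cosh_add_cosh_le_one_add_cosh (hy : y ^ 2 ≤ x ^ 2) (hz : z ^ 2 ≤ x ^ 2)
    (hxyz : (y ^ 2) ^ 2 + (z ^ 2) ^ 2 ≤ (x ^ 2) ^ 2)
    (h : 1 + Real.cosh x = Real.cosh y + Real.cosh z) (hp : 1 ≤ p) :
    Real.cosh (p * y) + Real.cosh (p * z) ≤ 1 + Real.cosh (p * x) := by
  suffices 0 ≤ 1 + Real.cosh (p * x) - Real.cosh (p * y) - Real.cosh (p * z) by linarith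
  refine (hasSum_one_add_cosh_sub_cosh_sub_cosh h p).nonneg fun k => ?_
  rcases Nat.eq_zero_or_pos k with rfl | hk
  · simp
  have hc := pow_add_pow_le_pow_of_sq_add_sq_le_sq (sq_nonneg y) (sq_nonneg z) hy hz hxyz
    (show 2 ≤ k + 1 by lia)
  refine mul_nonneg (div_nonneg (by linarith) (by positivity)) (sub_nonneg.2 ?_)
  exact le_self_pow₀ (one_le_pow₀ hp) k.succ_ne_zero

theorem one_add_cosh_le_cosh_add_cosh (hy : y ^ 2 ≤ x ^ 2) (hz : z ^ 2 ≤ x ^ 2)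
    (hxyz : (y ^ 2) ^ 2 + (z ^ 2) ^ 2 ≤ (x ^ 2) ^ 2)
    (h : 1 + Real.cosh x = Real.cosh y + Real.cosh z) (hp0 : 0 ≤ p) (hp1 : p ≤ 1) :
    1 + Real.cosh (p * x) ≤ Real.cosh (p * y) + Real.cosh (p * z) := by
  suffices 1 + Real.cosh (p * x) - Real.cosh (p * y) - Real.cosh (p * z) ≤ 0 by linarith
  refine (hasSum_one_add_cosh_sub_cosh_sub_cosh h p).nonpos fun k => ?_
  rcases Nat.eq_zero_or_pos k with rfl | hk
  · simp
  have hc := pow_add_pow_le_pow_of_sq_add_sq_le_sq (sq_nonneg y) (sq_nonneg z) hy hz hxyz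
    (show 2 ≤ k + 1 by lia)
  refine mul_nonpos_of_nonneg_of_nonpos (div_nonneg (by linarith) (by positivity))
    (sub_nonpos.2 ?_)
  exact pow_le_of_le_one (sq_nonneg p) (pow_le_one₀ hp0 hp1) k.succ_ne_zero

end

theorem ten_mul_arcosh_three_le : 10 * Real.arcosh 3 ≤ 19 * Real.arcosh (3 / 2) := by
  have h8 : √(3 ^ 2 - 1 : ℝ) ≤ 2.83 := Real.sqrt_le_iff.2 (by norm_num)
  have h5 : (1.118 : ℝ) ≤ √((3 / 2) ^ 2 - 1) := Real.le_sqrt_of_sq_le (by norm_num)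
  rw [← Real.exp_le_exp]
  calc Real.exp (10 * Real.arcosh 3) = (3 + √(3 ^ 2 - 1)) ^ 10 := by
        rw [← Real.exp_arcosh (by norm_num), ← Real.exp_nat_mul]; norm_num
    _ ≤ (3 + 2.83) ^ 10 := by gcongr
    _ ≤ (3 / 2 + 1.118) ^ 19 := by norm_num
    _ ≤ (3 / 2 + √((3 / 2) ^ 2 - 1)) ^ 19 := by gcongr
    _ = Real.exp (19 * Real.arcosh (3 / 2)) := by
        rw [← Real.exp_arcosh (by norm_num), ← Real.exp_nat_mul]; norm_num

theorem klemes_eigenvalue_power_majorization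
    (hX : (matA * matAᵀ).IsHermitian) (hY : (matB * matBᵀ).IsHermitian) :
    (∀ i, 0 < hX.eigenvalues i) ∧ (∀ i, 0 < hY.eigenvalues i) ∧
    (∀ p : ℝ, 1 ≤ p → ∑ i, hY.eigenvalues i ^ p ≤ ∑ i, hX.eigenvalues i ^ p) ∧
      ∀ p : ℝ, 0 < p → p < 1 → ∑ i, hX.eigenvalues i ^ p ≤ ∑ i, hY.eigenvalues i ^ p := by
  set u := Real.arcosh (3 / 2)
  set v := Real.arcosh 3
  have hcu : Real.cosh u = 3 / 2 := Real.cosh_arcosh (by norm_num)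
  have hcv : Real.cosh v = 3 := Real.cosh_arcosh (by norm_num)
  have hcx : Real.cosh (2 * u) = 7 / 2 := by
    rw [Real.cosh_two_mul, Real.sinh_sq, hcu]; norm_num
  have hu0 : 0 ≤ u := Real.arcosh_nonneg (by norm_num)
  have hv0 : 0 ≤ v := Real.arcosh_nonneg (by norm_num)
  have hvu : v ^ 2 ≤ 3.61 * u ^ 2 := by
    have : v ≤ 1.9 * u := by linarith [ten_mul_arcosh_three_le]
    calc v ^ 2 ≤ (1.9 * u) ^ 2 := by gcongr
      _ = 3.61 * u ^ 2 := by ring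
  have hspecX := hX.map_eigenvalues_eq_of_charpoly_eq
    (s := {Real.exp 0, Real.exp (-0), Real.exp (2 * u), Real.exp (-(2 * u))}) (by
      rw [prod_X_sub_C_exp, charpoly_matA_mul_transpose, hcx, Real.cosh_zero]
      norm_num [map_ofNat Polynomial.C])
  have hspecY := hY.map_eigenvalues_eq_of_charpoly_eq
    (s := {Real.exp u, Real.exp (-u), Real.exp v, Real.exp (-v)}) (by
      rw [prod_X_sub_C_exp, charpoly_matB_mul_transpose, hcu, hcv]
      norm_num [map_ofNat Polynomial.C])
  have hy : u ^ 2 ≤ (2 * u) ^ 2 := by nlinarith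
  have hz : v ^ 2 ≤ (2 * u) ^ 2 := by nlinarith
  have hxyz : (u ^ 2) ^ 2 + (v ^ 2) ^ 2 ≤ ((2 * u) ^ 2) ^ 2 := by
    calc (u ^ 2) ^ 2 + (v ^ 2) ^ 2 ≤ (u ^ 2) ^ 2 + (3.61 * u ^ 2) ^ 2 := by gcongr
      _ ≤ ((2 * u) ^ 2) ^ 2 := by nlinarith [sq_nonneg (u ^ 2)]
  have h1 : 1 + Real.cosh (2 * u) = Real.cosh u + Real.cosh v := by
    rw [hcx, hcu, hcv]; norm_num
  refine ⟨pos_of_map_univ_eq_exp hspecX, pos_of_map_univ_eq_exp hspecY,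
    fun p hp => ?_, fun p hp0 hp1 => ?_⟩ <;>
    rw [sum_rpow_eq_cosh_of_map_univ_eq_exp hspecX, sum_rpow_eq_cosh_of_map_univ_eq_exp hspecY,
      mul_zero, Real.cosh_zero]
  · linarith [cosh_add_cosh_le_one_add_cosh hy hz hxyz h1 hp]
  · linarith [one_add_cosh_le_cosh_add_cosh hy hz hxyz h1 hp0.le hp1.le]
end

section
/- Let n ≥ 1, let p ≥ 1 be real, and define f: (1,∞) → ℝ by f(u) = (u + √(u² − 1))^p + (u − √(u² − 1))^p. Then for all real u_1 ≥ u_2 > 1, f′(u_1) ≥ f′(u_2); more precisely, f′(u) = p·((u + √(u² − 1))^p − (u − √(u² − 1))^p)/√(u² − 1) for u > 1, and this expression is monotone increasing in u on (1,∞). -/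
lemma monotoneOn_sinh_mul_div_sinh {p : ℝ} (hp : 1 ≤ p) :
    MonotoneOn (fun t => Real.sinh (p * t) / Real.sinh t) (Set.Ioi 0) := by
  have hd : ∀ x ∈ Set.Ioi (0 : ℝ), HasDerivAt (fun t => Real.sinh (p * t) / Real.sinh t)
      ((Real.cosh (p * x) * p * Real.sinh x - Real.sinh (p * x) * Real.cosh x) /
        Real.sinh x ^ 2) x := fun x hx => by
    have hm : HasDerivAt (fun x => p * x) p x := by simpa using (hasDerivAt_id x).const_mul p
    exact hm.sinh.div (Real.hasDerivAt_sinh x) (Real.sinh_pos_iff.2 hx).ne'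
  refine monotoneOn_of_deriv_nonneg (convex_Ioi 0)
    (fun x hx => (hd x hx).continuousAt.continuousWithinAt)
    (fun x hx => (hd x (interior_subset hx)).differentiableAt.differentiableWithinAt)
    fun x hx => ?_
  rw [interior_Ioi] at hx
  rw [(hd x hx).deriv]
  exact div_nonneg (by linarith [sinh_mul_mul_cosh_le hp (Set.mem_Ioi.1 hx).le]) (sq_nonneg _)

lemma sqrt_cosh_sq_sub_one {t : ℝ} (ht : 0 ≤ t) :
    Real.sqrt (Real.cosh t ^ 2 - 1) = Real.sinh t := by
  rw [Real.cosh_sq, add_sub_cancel_right, Real.sqrt_sq (Real.sinh_nonneg_iff.2 ht)]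

lemma rpow_sub_rpow_div_sqrt_cosh (p : ℝ) {t : ℝ} (ht : 0 ≤ t) :
    ((Real.cosh t + Real.sqrt (Real.cosh t ^ 2 - 1)) ^ p -
        (Real.cosh t - Real.sqrt (Real.cosh t ^ 2 - 1)) ^ p) /
      Real.sqrt (Real.cosh t ^ 2 - 1) = 2 * (Real.sinh (p * t) / Real.sinh t) := by
  rw [sqrt_cosh_sq_sub_one ht, Real.cosh_add_sinh, Real.cosh_sub_sinh, ← Real.exp_mul,
    ← Real.exp_mul, Real.sinh_eq (p * t), mul_comm t p, neg_mul, mul_comm t p]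
  ring

lemma hasDerivAt_rpow_add_rpow_sqrt (p : ℝ) {u : ℝ} (hu : 1 < u) :
    HasDerivAt
      (fun x : ℝ => (x + Real.sqrt (x ^ 2 - 1)) ^ p + (x - Real.sqrt (x ^ 2 - 1)) ^ p)
      (p * (((u + Real.sqrt (u ^ 2 - 1)) ^ p - (u - Real.sqrt (u ^ 2 - 1)) ^ p) /
        Real.sqrt (u ^ 2 - 1))) u := by
  have hq : 0 < u ^ 2 - 1 := by nlinarith
  have hs : 0 < Real.sqrt (u ^ 2 - 1) := Real.sqrt_pos.2 hq
  have hsub : 0 < u - Real.sqrt (u ^ 2 - 1) :=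
    sub_pos.2 ((Real.sqrt_lt' (by linarith)).2 (by linarith))
  have hadd : 0 < u + Real.sqrt (u ^ 2 - 1) := by linarith
  have hsqrt : HasDerivAt (fun x : ℝ => Real.sqrt (x ^ 2 - 1)) (u / Real.sqrt (u ^ 2 - 1)) u := by
    refine (((hasDerivAt_pow 2 u).sub_const 1).sqrt hq.ne').congr_deriv ?_
    field_simp
    simp
  refine ((((hasDerivAt_id' u).add hsqrt).rpow_const (p := p) (Or.inl hadd.ne')).add
    (((hasDerivAt_id' u).sub hsqrt).rpow_const (p := p) (Or.inl hsub.ne'))).congr_deriv ?_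
  simp only [Pi.add_apply, Pi.sub_apply]
  rw [Real.rpow_sub_one hadd.ne', Real.rpow_sub_one hsub.ne']
  field_simp
  ring

theorem f_deriv_and_monotone (n : ℕ) (hn : 1 ≤ n) (p : ℝ) (hp : 1 ≤ p) :
    (∀ u : ℝ, 1 < u →
      HasDerivAt
        (fun x : ℝ => (x + Real.sqrt (x ^ 2 - 1)) ^ p + (x - Real.sqrt (x ^ 2 - 1)) ^ p)
        (p * (((u + Real.sqrt (u ^ 2 - 1)) ^ p - (u - Real.sqrt (u ^ 2 - 1)) ^ p) /
          Real.sqrt (u ^ 2 - 1))) u) ∧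
    ∀ u₁ u₂ : ℝ, 1 < u₂ → u₂ ≤ u₁ →
      p * (((u₂ + Real.sqrt (u₂ ^ 2 - 1)) ^ p - (u₂ - Real.sqrt (u₂ ^ 2 - 1)) ^ p) /
          Real.sqrt (u₂ ^ 2 - 1)) ≤
        p * (((u₁ + Real.sqrt (u₁ ^ 2 - 1)) ^ p - (u₁ - Real.sqrt (u₁ ^ 2 - 1)) ^ p) /
          Real.sqrt (u₁ ^ 2 - 1)) := by
  refine ⟨fun u hu => hasDerivAt_rpow_add_rpow_sqrt p hu, fun u₁ u₂ h₂ h => ?_⟩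
  refine mul_le_mul_of_nonneg_left ?_ (by linarith)
  have h₁ : 1 < u₁ := h₂.trans_le h
  rw [← Real.cosh_arcosh h₁.le, ← Real.cosh_arcosh h₂.le,
    rpow_sub_rpow_div_sqrt_cosh p (Real.arcosh_nonneg h₁.le),
    rpow_sub_rpow_div_sqrt_cosh p (Real.arcosh_nonneg h₂.le)]
  exact mul_le_mul_of_nonneg_left (monotoneOn_sinh_mul_div_sinh hp (Real.arcosh_pos h₂)
    (Real.arcosh_pos h₁) ((Real.arcosh_le_arcosh (by linarith) (by linarith)).2 h)) zero_le_two
end
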